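/- Let (X,ω) be a strong left Frobenius pair in an abelian category C. Then: (a) (ω, X^∧) is an X^∧-cotorsion pair in C; (b) ω^∧ equals the smallest thick class of C containing ω. Consequently, ω = {W ∈ X^∧ : Ext^1_C(W,S) = 0 for all S ∈ X^∧}, i.e. ω is the class of projective objects of the exact category X^∧, and X^∧ has enough projectives (every object of X^∧ is a quotient of an object of ω with kernel in X^∧). -/

import Mathlib

/-!
Common definitions for Auslander–Buchweitz approximation theory in abelian
categories, following Becerril–Mendoza–Pérez–Santiago.
-/

open CategoryTheory CategoryTheory.Limits ZeroObject

universe w v u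

namespace ABFormal

variable {C : Type u} [Category.{v} C] [Abelian C] [CategoryTheory.HasExt.{w} C]

/-- `0 → A → B → C' → 0` is a short exact sequence in `C`. -/
def IsShortExactSeq {A B C' : C} (f : A ⟶ B) (g : B ⟶ C') : Prop :=
  ∃ w : f ≫ g = 0, (ShortComplex.mk f g w).ShortExact

/-- `ωω` is `XX`-injective: `Ext^i(X, W) = 0` for all `X ∈ XX`, `W ∈ ωω` and `i > 0`. -/
def IsRelInjective (XX ωω : Set C) : Prop :=
  ∀ W ∈ ωω, ∀ X ∈ XX, ∀ i : ℕ, 0 < i → Subsingleton (Abelian.Ext.{w} X W i)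

/-- `ωω` is `XX`-projective: `Ext^i(W, X) = 0` for all `X ∈ XX`, `W ∈ ωω` and `i > 0`. -/
def IsRelProjective (XX ωω : Set C) : Prop :=
  ∀ W ∈ ωω, ∀ X ∈ XX, ∀ i : ℕ, 0 < i → Subsingleton (Abelian.Ext.{w} W X i)

/-- `ωω` is a relative cogenerator in `XX`. -/
def IsRelCogenerator (XX ωω : Set C) : Prop :=
  ωω ⊆ XX ∧ ∀ X ∈ XX, ∃ (W X' : C) (i : X ⟶ W) (p : W ⟶ X'),
    W ∈ ωω ∧ X' ∈ XX ∧ IsShortExactSeq i p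

/-- `ωω` is a relative generator in `XX`. -/
def IsRelGenerator (XX ωω : Set C) : Prop :=
  ωω ⊆ XX ∧ ∀ X ∈ XX, ∃ (X' W : C) (i : X' ⟶ W) (p : W ⟶ X),
    W ∈ ωω ∧ X' ∈ XX ∧ IsShortExactSeq i p

/-- `id_XX(M) ≤ n` : `Ext^j(X, M) = 0` for all `X ∈ XX` and `j > n`. -/
def relInjDimLE (XX : Set C) (M : C) (n : ℕ) : Prop :=
  ∀ X ∈ XX, ∀ j : ℕ, n < j → Subsingleton (Abelian.Ext.{w} X M j)

/-- The relative injective dimension `id_XX(M) : ℕ∞`. -/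
noncomputable def relInjDim (XX : Set C) (M : C) : ℕ∞ :=
  sInf {m : ℕ∞ | ∃ n : ℕ, m = (n : ℕ∞) ∧ relInjDimLE XX M n}

/-- `pd_XX(M) ≤ n` : `Ext^j(M, X) = 0` for all `X ∈ XX` and `j > n`. -/
def relProjDimLE (XX : Set C) (M : C) (n : ℕ) : Prop :=
  ∀ X ∈ XX, ∀ j : ℕ, n < j → Subsingleton (Abelian.Ext.{w} M X j)

/-- The relative projective dimension `pd_XX(M) : ℕ∞`. -/
noncomputable def relProjDim (XX : Set C) (M : C) : ℕ∞ :=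
  sInf {m : ℕ∞ | ∃ n : ℕ, m = (n : ℕ∞) ∧ relProjDimLE XX M n}

/-- There is an exact sequence `0 → X_n → ⋯ → X_0 → M → 0` with all `X_i ∈ XX`
(a resolution of length `n`). -/
inductive HasResolutionLength (XX : Set C) : ℕ → C → Prop
  | zero {M X : C} (hX : X ∈ XX) (e : X ≅ M) : HasResolutionLength XX 0 M
  | succ {n : ℕ} {M : C} (K X : C) (hX : X ∈ XX)
      (i : K ⟶ X) (p : X ⟶ M) (hse : IsShortExactSeq i p)
      (hK : HasResolutionLength XX n K) : HasResolutionLength XX (n + 1) M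

/-- The `XX`-resolution dimension `resdim_XX(M) : ℕ∞`. -/
noncomputable def resDim (XX : Set C) (M : C) : ℕ∞ :=
  sInf {m : ℕ∞ | ∃ n : ℕ, m = (n : ℕ∞) ∧ HasResolutionLength XX n M}

/-- `XX^∧`, the class of objects with a finite `XX`-resolution. -/
def resHat (XX : Set C) : Set C :=
  {M | ∃ n : ℕ, HasResolutionLength XX n M}

/-- There is an exact sequence `0 → M → X^0 → ⋯ → X^n → 0` with all `X^i ∈ XX`
(a coresolution of length `n`). -/
inductive HasCoresolutionLength (XX : Set C) : ℕ → C → Prop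
  | zero {M X : C} (hX : X ∈ XX) (e : M ≅ X) : HasCoresolutionLength XX 0 M
  | succ {n : ℕ} {M : C} (X Q : C) (hX : X ∈ XX)
      (i : M ⟶ X) (p : X ⟶ Q) (hse : IsShortExactSeq i p)
      (hQ : HasCoresolutionLength XX n Q) : HasCoresolutionLength XX (n + 1) M

/-- The `XX`-coresolution dimension `coresdim_XX(M) : ℕ∞`. -/
noncomputable def coresDim (XX : Set C) (M : C) : ℕ∞ :=
  sInf {m : ℕ∞ | ∃ n : ℕ, m = (n : ℕ∞) ∧ HasCoresolutionLength XX n M}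

/-- `XX^∨`, the class of objects with a finite `XX`-coresolution. -/
def coresVee (XX : Set C) : Set C :=
  {M | ∃ n : ℕ, HasCoresolutionLength XX n M}

/-- `IsSyzygyOf XX n M K` : there is an exact sequence
`0 → K → X_{n-1} → ⋯ → X_0 → M → 0` with all `X_i ∈ XX`. -/
inductive IsSyzygyOf (XX : Set C) : ℕ → C → C → Prop
  | zero {M K : C} (e : K ≅ M) : IsSyzygyOf XX 0 M K
  | succ {n : ℕ} {M : C} (K X L : C) (hX : X ∈ XX)
      (i : K ⟶ X) (p : X ⟶ L) (hse : IsShortExactSeq i p)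
      (hL : IsSyzygyOf XX n M L) : IsSyzygyOf XX (n + 1) M K

/-- `XX^⊥ = {N | Ext^i(X, N) = 0 for all X ∈ XX, i > 0}`. -/
def rightPerp (XX : Set C) : Set C :=
  {N | ∀ X ∈ XX, ∀ i : ℕ, 0 < i → Subsingleton (Abelian.Ext.{w} X N i)}

/-- `XX^{⊥₁} = {N | Ext^1(X, N) = 0 for all X ∈ XX}`. -/
def rightPerp1 (XX : Set C) : Set C :=
  {N | ∀ X ∈ XX, Subsingleton (Abelian.Ext.{w} X N 1)}

/-- `^⊥XX = {N | Ext^i(N, X) = 0 for all X ∈ XX, i > 0}`. -/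
def leftPerp (XX : Set C) : Set C :=
  {N | ∀ X ∈ XX, ∀ i : ℕ, 0 < i → Subsingleton (Abelian.Ext.{w} N X i)}

/-- `^{⊥₁}XX = {N | Ext^1(N, X) = 0 for all X ∈ XX}`. -/
def leftPerp1 (XX : Set C) : Set C :=
  {N | ∀ X ∈ XX, Subsingleton (Abelian.Ext.{w} N X 1)}

/-- Closed under extensions. -/
def ClosedUnderExtensions (XX : Set C) : Prop :=
  ∀ ⦃A B C' : C⦄ (f : A ⟶ B) (g : B ⟶ C'), IsShortExactSeq f g →
    A ∈ XX → C' ∈ XX → B ∈ XX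

/-- Closed under kernels of epimorphisms between objects of the class. -/
def ClosedUnderKernelsOfEpis (XX : Set C) : Prop :=
  ∀ ⦃A B C' : C⦄ (f : A ⟶ B) (g : B ⟶ C'), IsShortExactSeq f g →
    B ∈ XX → C' ∈ XX → A ∈ XX

/-- Closed under cokernels of monomorphisms between objects of the class. -/
def ClosedUnderCokernelsOfMonos (XX : Set C) : Prop :=
  ∀ ⦃A B C' : C⦄ (f : A ⟶ B) (g : B ⟶ C'), IsShortExactSeq f g →
    A ∈ XX → B ∈ XX → C' ∈ XX

/-- Closed under direct summands (retracts) in `C`. -/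
def ClosedUnderSummands (XX : Set C) : Prop :=
  ∀ ⦃X A : C⦄, X ∈ XX → ∀ (s : A ⟶ X) (r : X ⟶ A), s ≫ r = 𝟙 A → A ∈ XX

/-- Pre-resolving class: closed under extensions and kernels of epimorphisms. -/
def IsPreresolving (XX : Set C) : Prop :=
  ClosedUnderExtensions XX ∧ ClosedUnderKernelsOfEpis XX

/-- Pre-coresolving class: closed under extensions and cokernels of monomorphisms. -/
def IsPrecoresolving (XX : Set C) : Prop :=
  ClosedUnderExtensions XX ∧ ClosedUnderCokernelsOfMonos XX

/-- Left thick class. -/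
def IsLeftThick (XX : Set C) : Prop :=
  IsPreresolving XX ∧ ClosedUnderSummands XX

/-- Right thick class. -/
def IsRightThick (XX : Set C) : Prop :=
  IsPrecoresolving XX ∧ ClosedUnderSummands XX

/-- Thick class. -/
def IsThickClass (XX : Set C) : Prop :=
  IsLeftThick XX ∧ IsRightThick XX

/-- The smallest thick class of `C` containing `S`. -/
def thickClosure (S : Set C) : Set C :=
  ⋂₀ {T : Set C | IsThickClass T ∧ S ⊆ T}

/-- The class of projective objects of `C`. -/
def ProjClass (C : Type u) [Category.{v} C] : Set C := {P | Projective P}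

/-- The class of injective objects of `C`. -/
def InjClass (C : Type u) [Category.{v} C] : Set C := {I | Injective I}

/-- Resolving class in `C`: pre-resolving and containing all projectives. -/
def IsResolvingClass (XX : Set C) : Prop :=
  IsPreresolving XX ∧ ProjClass C ⊆ XX

/-- Coresolving class in `C`: pre-coresolving and containing all injectives. -/
def IsCoresolvingClass (XX : Set C) : Prop :=
  IsPrecoresolving XX ∧ InjClass C ⊆ XX

/-- A left Frobenius pair `(XX, ωω)` in `C`. -/
structure LeftFrobeniusPair (XX ωω : Set C) : Prop where
  leftThick : IsLeftThick XX
  relInj : IsRelInjective XX ωω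
  relCogen : IsRelCogenerator XX ωω
  summands : ClosedUnderSummands ωω

/-- A strong left Frobenius pair `(XX, ωω)` in `C`. -/
structure StrongLeftFrobeniusPair (XX ωω : Set C) extends LeftFrobeniusPair XX ωω : Prop where
  relProj : IsRelProjective XX ωω
  relGen : IsRelGenerator XX ωω

/-- A right Frobenius pair `(νν, YY)` in `C`. -/
structure RightFrobeniusPair (νν YY : Set C) : Prop where
  rightThick : IsRightThick YY
  relProj : IsRelProjective YY νν
  relGen : IsRelGenerator YY νν
  summands : ClosedUnderSummands νν

/-- `φ : X ⟶ M` is an `XX`-precover of `M`. -/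
def IsPrecover (XX : Set C) {X M : C} (φ : X ⟶ M) : Prop :=
  X ∈ XX ∧ ∀ (X' : C), X' ∈ XX → ∀ f : X' ⟶ M, ∃ h : X' ⟶ X, h ≫ φ = f

/-- `φ : M ⟶ Y` is an `XX`-preenvelope of `M`. -/
def IsPreenvelope (XX : Set C) {M Y : C} (φ : M ⟶ Y) : Prop :=
  Y ∈ XX ∧ ∀ (Y' : C), Y' ∈ XX → ∀ f : M ⟶ Y', ∃ h : Y ⟶ Y', φ ≫ h = f

/-- A left `S`-cotorsion pair `(F, G)` in `C`. -/
def IsLeftCotorsionPair (S F G : Set C) : Prop :=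
  F ⊆ S ∧ G ⊆ S ∧
  F = {A | A ∈ S ∧ ∀ G' ∈ G, Subsingleton (Abelian.Ext.{w} A G' 1)} ∧
  ∀ s ∈ S, ∃ (G' F' : C) (i : G' ⟶ F') (p : F' ⟶ s),
    G' ∈ G ∧ F' ∈ F ∧ IsShortExactSeq i p

/-- A right `S`-cotorsion pair `(F, G)` in `C`. -/
def IsRightCotorsionPair (S F G : Set C) : Prop :=
  F ⊆ S ∧ G ⊆ S ∧
  G = {A | A ∈ S ∧ ∀ F' ∈ F, Subsingleton (Abelian.Ext.{w} F' A 1)} ∧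
  ∀ s ∈ S, ∃ (G' F' : C) (i : s ⟶ G') (p : G' ⟶ F'),
    G' ∈ G ∧ F' ∈ F ∧ IsShortExactSeq i p

/-- An `S`-cotorsion pair `(F, G)` in `C`. -/
def IsCotorsionPair (S F G : Set C) : Prop :=
  IsLeftCotorsionPair S F G ∧ IsRightCotorsionPair S F G

/-- A left weak AB context `(AA, BB)` in `C`. -/
structure LeftWeakABContext (AA BB : Set C) : Prop where
  frob : LeftFrobeniusPair AA (AA ∩ BB)
  rightThick : IsRightThick BB
  sub : BB ⊆ resHat AA

section ShortExact

variable {C : Type u} [Category.{v} C] [Abelian C]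

theorem IsShortExactSeq.mono {A B D : C} {f : A ⟶ B} {g : B ⟶ D}
    (h : IsShortExactSeq f g) : Mono f := h.2.mono_f

theorem IsShortExactSeq.epi {A B D : C} {f : A ⟶ B} {g : B ⟶ D}
    (h : IsShortExactSeq f g) : Epi g := h.2.epi_g

theorem IsShortExactSeq.exists_lift {A B D T : C} {f : A ⟶ B} {g : B ⟶ D}
    (h : IsShortExactSeq f g) (t : T ⟶ B) (ht : t ≫ g = 0) : ∃ l : T ⟶ A, l ≫ f = t :=
  have := h.mono
  ⟨h.2.exact.lift t ht, h.2.exact.lift_f t ht⟩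

theorem IsShortExactSeq.of_lift {A B D : C} {f : A ⟶ B} {g : B ⟶ D} [Mono f] [Epi g]
    (w : f ≫ g = 0) (h : ∀ ⦃T : C⦄ (t : T ⟶ B), t ≫ g = 0 → ∃ l : T ⟶ A, l ≫ f = t) :
    IsShortExactSeq f g := by
  refine ⟨w, .mk' (ShortComplex.exact_of_f_is_kernel _ ?_) ‹_› ‹_›⟩
  exact KernelFork.IsLimit.ofι _ w (fun t ht => (h t ht).choose)
    (fun t ht => (h t ht).choose_spec)
    (fun t ht m hm => by rw [← cancel_mono f, hm, (h t ht).choose_spec])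

theorem isShortExactSeq_kernel {B D : C} (g : B ⟶ D) [Epi g] :
    IsShortExactSeq (kernel.ι g) g :=
  .of_lift (kernel.condition g) fun _ t ht => ⟨kernel.lift g t ht, kernel.lift_ι g t ht⟩

theorem isShortExactSeq_id_zero (M : C) : IsShortExactSeq (𝟙 M) (0 : M ⟶ (0 : C)) :=
  have : Epi (0 : M ⟶ (0 : C)) := ⟨fun _ _ _ => (isZero_zero C).eq_of_src _ _⟩
  .of_lift (by simp) fun _ t _ => ⟨t, by simp⟩

theorem isShortExactSeq_biprod (A B : C) :
    IsShortExactSeq (biprod.inr : B ⟶ A ⊞ B) (biprod.fst : A ⊞ B ⟶ A) :=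
  .of_lift (by simp) fun _ t ht => ⟨t ≫ biprod.snd, by ext <;> simp [ht]⟩

theorem IsShortExactSeq.comp_iso {A B D E : C} {f : A ⟶ B} {g : B ⟶ D}
    (h : IsShortExactSeq f g) (e : D ≅ E) : IsShortExactSeq f (g ≫ e.hom) := by
  have := h.mono
  have := h.epi
  refine .of_lift (by simp [reassoc_of% h.1]) fun T t ht => h.exists_lift t ?_
  rwa [← cancel_mono e.hom, zero_comp, Category.assoc]

theorem IsShortExactSeq.pullback_snd {K X M B : C} {i : K ⟶ X} {p : X ⟶ M}
    (h : IsShortExactSeq i p) (q : B ⟶ M) :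
    IsShortExactSeq (pullback.lift i 0 (by simp [h.1]) : K ⟶ pullback p q)
      (pullback.snd p q) := by
  have := h.mono
  have := h.epi
  have : Mono (pullback.lift i 0 (by simp [h.1]) : K ⟶ pullback p q) :=
    mono_of_mono_fac (pullback.lift_fst _ _ _)
  refine .of_lift (pullback.lift_snd _ _ _) fun T t ht => ?_
  obtain ⟨l, hl⟩ := h.exists_lift (t ≫ pullback.fst p q)
    (by simp [pullback.condition, reassoc_of% ht])
  exact ⟨l, pullback.hom_ext (by rw [Category.assoc, pullback.lift_fst, hl])
    (by rw [Category.assoc, pullback.lift_snd, comp_zero, ht])⟩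

theorem IsShortExactSeq.pullback_fst {A X M B : C} {j : A ⟶ B} {q : B ⟶ M}
    (h : IsShortExactSeq j q) (p : X ⟶ M) :
    IsShortExactSeq (pullback.lift 0 j (by simp [h.1]) : A ⟶ pullback p q)
      (pullback.fst p q) := by
  have := h.mono
  have := h.epi
  have : Mono (pullback.lift 0 j (by simp [h.1]) : A ⟶ pullback p q) :=
    mono_of_mono_fac (pullback.lift_snd _ _ _)
  refine .of_lift (pullback.lift_fst _ _ _) fun T t ht => ?_
  obtain ⟨l, hl⟩ := h.exists_lift (t ≫ pullback.snd p q)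
    (by simp [← pullback.condition, reassoc_of% ht])
  exact ⟨l, pullback.hom_ext (by rw [Category.assoc, pullback.lift_fst, comp_zero, ht])
    (by rw [Category.assoc, pullback.lift_snd, hl])⟩

/-- The kernel of a composite of epimorphisms is an extension of the two kernels. -/
theorem IsShortExactSeq.exists_comp {K X B L D : C} {i : K ⟶ X} {p : X ⟶ B}
    {j : L ⟶ B} {q : B ⟶ D} (h : IsShortExactSeq i p) (h' : IsShortExactSeq j q) :
    ∃ (Q : C) (a : K ⟶ Q) (b : Q ⟶ L) (c : Q ⟶ X),
      IsShortExactSeq a b ∧ IsShortExactSeq c (p ≫ q) := by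
  have := h.epi
  have := h'.epi
  have := h'.mono
  refine ⟨pullback p j, _, _, pullback.fst p j, h.pullback_snd j, ?_⟩
  refine .of_lift (by simp [pullback.condition_assoc, h'.1]) fun T t ht => ?_
  obtain ⟨l, hl⟩ := h'.exists_lift (t ≫ p) (by simpa using ht)
  exact ⟨pullback.lift t l hl.symm, pullback.lift_fst _ _ _⟩

theorem IsShortExactSeq.exists_swap {A B D : C} {f : A ⟶ B} {g : B ⟶ D}
    (h : IsShortExactSeq f g) (s : D ⟶ B) (hs : s ≫ g = 𝟙 D) :
    ∃ r : B ⟶ A, f ≫ r = 𝟙 A ∧ IsShortExactSeq s r := by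
  have := h.mono
  obtain ⟨r, hr⟩ := h.exists_lift (𝟙 B - g ≫ s) (by simp [hs])
  have hfr : f ≫ r = 𝟙 A := by
    rw [← cancel_mono f, Category.assoc, hr]
    simp [reassoc_of% h.1]
  have : Mono s := mono_of_mono_fac hs
  have : Epi r := epi_of_epi_fac hfr
  refine ⟨r, hfr, .of_lift ?_ fun T t ht => ⟨t ≫ g, ?_⟩⟩
  · rw [← cancel_mono f, Category.assoc, hr]
    simp [reassoc_of% hs]
  · have : t ≫ r ≫ f = 0 := by rw [reassoc_of% ht, zero_comp]
    rw [hr, Preadditive.comp_sub, Category.comp_id, sub_eq_zero] at this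
    rw [Category.assoc, ← this]

end ShortExact

section ExtVanishing

theorem IsShortExactSeq.ext_covariant_vanishing {A B D : C} {f : A ⟶ B} {g : B ⟶ D}
    (h : IsShortExactSeq f g) (W : C) (n : ℕ) (hB : Subsingleton (Abelian.Ext.{w} W B n))
    (hA : Subsingleton (Abelian.Ext.{w} W A (n + 1))) :
    Subsingleton (Abelian.Ext.{w} W D n) := by
  refine subsingleton_of_forall_eq 0 fun x => ?_
  obtain ⟨y, rfl⟩ := Abelian.Ext.covariant_sequence_exact₃ W h.2 x rfl (hA.elim _ _)
  rw [hB.elim y 0, Abelian.Ext.zero_comp]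

theorem IsShortExactSeq.ext_middle_vanishing {A B D : C} {f : A ⟶ B} {g : B ⟶ D}
    (h : IsShortExactSeq f g) (S : C) (n : ℕ) (hA : Subsingleton (Abelian.Ext.{w} A S n))
    (hD : Subsingleton (Abelian.Ext.{w} D S n)) :
    Subsingleton (Abelian.Ext.{w} B S n) := by
  refine subsingleton_of_forall_eq 0 fun x => ?_
  obtain ⟨y, rfl⟩ := Abelian.Ext.contravariant_sequence_exact₂ h.2 S x (hA.elim _ _)
  rw [hD.elim y 0, Abelian.Ext.comp_zero]

theorem IsShortExactSeq.ext_left_vanishing {A B D : C} {f : A ⟶ B} {g : B ⟶ D}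
    (h : IsShortExactSeq f g) (S : C) (n : ℕ) (hB : Subsingleton (Abelian.Ext.{w} B S n))
    (hD : Subsingleton (Abelian.Ext.{w} D S (n + 1))) :
    Subsingleton (Abelian.Ext.{w} A S n) := by
  refine subsingleton_of_forall_eq 0 fun x => ?_
  obtain ⟨y, rfl⟩ := Abelian.Ext.contravariant_sequence_exact₁ h.2 S x (add_comm 1 n)
    (hD.elim _ _)
  rw [hB.elim y 0, Abelian.Ext.comp_zero]

theorem IsShortExactSeq.ext_right_vanishing {A B D : C} {f : A ⟶ B} {g : B ⟶ D}
    (h : IsShortExactSeq f g) (S : C) (n : ℕ) (hA : Subsingleton (Abelian.Ext.{w} A S n))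
    (hB : Subsingleton (Abelian.Ext.{w} B S (n + 1))) :
    Subsingleton (Abelian.Ext.{w} D S (n + 1)) := by
  refine subsingleton_of_forall_eq 0 fun x => ?_
  obtain ⟨y, rfl⟩ := Abelian.Ext.contravariant_sequence_exact₃ h.2 S x (hB.elim _ _)
    (add_comm 1 n)
  rw [hA.elim y 0, Abelian.Ext.comp_zero]

theorem ext_vanishing_of_retract {A X : C} (s : A ⟶ X) (r : X ⟶ A) (h : s ≫ r = 𝟙 A)
    (S : C) (n : ℕ) (hX : Subsingleton (Abelian.Ext.{w} X S n)) :
    Subsingleton (Abelian.Ext.{w} A S n) := by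
  refine subsingleton_of_forall_eq 0 fun x => ?_
  rw [← Abelian.Ext.mk₀_id_comp x, ← h, ← Abelian.Ext.mk₀_comp_mk₀_assoc,
    hX.elim ((Abelian.Ext.mk₀ r).comp x (zero_add n)) 0, Abelian.Ext.comp_zero]

theorem IsShortExactSeq.exists_factor {A B D W : C} {f : A ⟶ B} {g : B ⟶ D}
    (h : IsShortExactSeq f g) (hW : Subsingleton (Abelian.Ext.{w} W A 1)) (t : W ⟶ D) :
    ∃ l : W ⟶ B, l ≫ g = t := by
  obtain ⟨y, hy⟩ := Abelian.Ext.covariant_sequence_exact₃ W h.2 (Abelian.Ext.mk₀ t)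
    (zero_add 1) (hW.elim _ _)
  obtain ⟨l, rfl⟩ := Abelian.Ext.mk₀_bijective W B |>.2 y
  rw [Abelian.Ext.mk₀_comp_mk₀] at hy
  exact ⟨l, Abelian.Ext.mk₀_bijective W D |>.1 hy⟩

end ExtVanishing

theorem ClosedUnderSummands.mem_of_iso {C : Type u} [Category.{v} C] {XX : Set C}
    (h : ClosedUnderSummands XX) {X Y : C} (hX : X ∈ XX) (e : X ≅ Y) : Y ∈ XX :=
  h hX e.inv e.hom e.inv_hom_id

section Resolutions

variable {C : Type u} [Category.{v} C] [Abelian C]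

theorem subset_resHat (XX : Set C) : XX ⊆ resHat XX :=
  fun _ hX => ⟨0, .zero hX (Iso.refl _)⟩

theorem HasResolutionLength.mono {XX YY : Set C} (h : XX ⊆ YY) {n : ℕ} {M : C}
    (hM : HasResolutionLength XX n M) : HasResolutionLength YY n M := by
  induction hM with
  | zero hX e => exact .zero (h hX) e
  | succ K X hX i p hse _ ih => exact .succ K X (h hX) i p hse ih

theorem mem_resHat_of_isShortExactSeq {XX : Set C} {K X M : C} {i : K ⟶ X} {p : X ⟶ M}
    (h : IsShortExactSeq i p) (hX : X ∈ XX) (hK : K ∈ resHat XX) : M ∈ resHat XX :=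
  hK.elim fun n hn => ⟨n + 1, .succ K X hX i p h hn⟩

/-- An extension of an object of resolution length `n` by an object of `XX` has resolution
length `n`. -/
theorem HasResolutionLength.of_extension {XX : Set C} (hX : IsLeftThick XX) {n : ℕ}
    {X K M : C} {i : X ⟶ K} {p : K ⟶ M} (h : IsShortExactSeq i p) (hXX : X ∈ XX)
    (hM : HasResolutionLength XX n M) : HasResolutionLength XX n K := by
  cases hM with
  | zero hY e =>
    exact .zero (hX.1.1 i p h hXX (hX.2.mem_of_iso hY e)) (Iso.refl _)
  | succ L Y hY j q hse hL =>
    exact .succ L _ (hX.1.1 _ _ (h.pullback_fst q) hXX hY) _ _ (hse.pullback_snd p) hL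

theorem resHat_subset_of_isThickClass {S T : Set C} (hT : IsThickClass T) (hST : S ⊆ T) :
    resHat S ⊆ T := by
  rintro M ⟨n, hM⟩
  induction hM with
  | zero hX e => exact hT.1.2.mem_of_iso (hST hX) e
  | succ K X hX i p hse _ ih => exact hT.2.1.2 i p hse ih (hST hX)

end Resolutions

namespace StrongLeftFrobeniusPair

variable {XX ωω : Set C}

theorem ext_vanishing (hfrob : StrongLeftFrobeniusPair XX ωω) {W M : C} (hW : W ∈ ωω)
    (hM : M ∈ resHat XX) {i : ℕ} (hi : 0 < i) : Subsingleton (Abelian.Ext.{w} W M i) := by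
  obtain ⟨n, hM⟩ := hM
  induction hM generalizing i with
  | zero hX e =>
    exact hfrob.relProj W hW _ (hfrob.leftThick.2.mem_of_iso hX e) i hi
  | succ K X hX j p hse _ ih =>
    exact hse.ext_covariant_vanishing W i (hfrob.relProj W hW X hX i hi) (ih i.succ_pos)

theorem exists_omega_of_succ (hfrob : StrongLeftFrobeniusPair XX ωω) {n : ℕ} {M : C}
    (hM : HasResolutionLength XX (n + 1) M) :
    ∃ (K W : C) (i : K ⟶ W) (p : W ⟶ M),
      W ∈ ωω ∧ HasResolutionLength XX n K ∧ IsShortExactSeq i p := by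
  cases hM with
  | succ L X hX j q hse hL =>
    obtain ⟨X', W, a, b, hW, hX', hab⟩ := hfrob.relGen.2 X hX
    obtain ⟨Q, c, d, e, hcd, he⟩ := hab.exists_comp hse
    exact ⟨Q, W, e, b ≫ q, hW, .of_extension hfrob.leftThick hcd hX' hL, he⟩

theorem exists_omega (hfrob : StrongLeftFrobeniusPair XX ωω) {M : C} (hM : M ∈ resHat XX) :
    ∃ (K W : C) (i : K ⟶ W) (p : W ⟶ M),
      W ∈ ωω ∧ K ∈ resHat XX ∧ IsShortExactSeq i p := by
  obtain ⟨_ | n, hn⟩ := hM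
  · cases hn with
    | zero hX e =>
      obtain ⟨K, W, i, p, hW, hK, h⟩ := hfrob.relGen.2 _ hX
      exact ⟨K, W, i, p ≫ e.hom, hW, subset_resHat _ hK, h.comp_iso e⟩
  · obtain ⟨K, W, i, p, hW, hK, h⟩ := hfrob.exists_omega_of_succ hn
    exact ⟨K, W, i, p, hW, ⟨n, hK⟩, h⟩

theorem mem_omega_of_ext_vanishing (hfrob : StrongLeftFrobeniusPair XX ωω) {M : C}
    (hM : M ∈ resHat XX) (h : ∀ S ∈ resHat XX, Subsingleton (Abelian.Ext.{w} M S 1)) :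
    M ∈ ωω := by
  obtain ⟨K, W, i, p, hW, hK, hse⟩ := hfrob.exists_omega hM
  obtain ⟨s, hs⟩ := hse.exists_factor (h K hK) (𝟙 M)
  exact hfrob.summands hW s p hs

theorem omega_eq (hfrob : StrongLeftFrobeniusPair XX ωω) :
    ωω = {W | W ∈ resHat XX ∧ ∀ S ∈ resHat XX, Subsingleton (Abelian.Ext.{w} W S 1)} :=
  Set.Subset.antisymm
    (fun _ hW => ⟨subset_resHat _ (hfrob.relGen.1 hW),
      fun _ hS => hfrob.ext_vanishing hW hS one_pos⟩)
    (fun _ hW => hfrob.mem_omega_of_ext_vanishing hW.1 hW.2)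

theorem resHat_closedUnderExtensions (hfrob : StrongLeftFrobeniusPair XX ωω) :
    ClosedUnderExtensions (resHat XX) := by
  rintro A B D f g h ⟨m, hA⟩ hD
  induction m generalizing A B D with
  | zero =>
    cases hA with
    | zero hX e =>
      exact hD.imp fun _ hn =>
        .of_extension hfrob.leftThick h (hfrob.leftThick.2.mem_of_iso hX e) hn
  | succ m ih =>
    obtain ⟨K, W, i, p, hW, hK, hse⟩ := hfrob.exists_omega hD
    obtain ⟨s, hs⟩ := (h.pullback_fst p).exists_factor
      (hfrob.ext_vanishing hW ⟨m + 1, hA⟩ one_pos) (𝟙 W)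
    obtain ⟨r, -, hr⟩ := (h.pullback_fst p).exists_swap s hs
    cases hA with
    | succ L X hX j q hjq hL =>
      obtain ⟨Q, a, b, c, hab, hc⟩ := (hjq.pullback_snd r).exists_comp (hse.pullback_snd g)
      exact mem_resHat_of_isShortExactSeq hc
        (hfrob.leftThick.1.1 _ _ (hr.pullback_fst q) (hfrob.relGen.1 hW) hX)
        (ih a b hab hL hK)

theorem resHat_closedUnderCokernelsOfMonos (hfrob : StrongLeftFrobeniusPair XX ωω) :
    ClosedUnderCokernelsOfMonos (resHat XX) := by
  intro A B D f g h hA hB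
  obtain ⟨K, W, i, p, hW, hK, hse⟩ := hfrob.exists_omega hB
  obtain ⟨Q, a, b, c, hab, hc⟩ := hse.exists_comp h
  exact mem_resHat_of_isShortExactSeq hc (hfrob.relGen.1 hW)
    (hfrob.resHat_closedUnderExtensions a b hab hK hA)

theorem resHat_closedUnderKernelsOfEpis (hfrob : StrongLeftFrobeniusPair XX ωω) :
    ClosedUnderKernelsOfEpis (resHat XX) := by
  intro A B D f g h hB hD
  obtain ⟨K, W, i, p, hW, hK, hse⟩ := hfrob.exists_omega hD
  have hP := hfrob.resHat_closedUnderExtensions _ _ (hse.pullback_snd g) hK hB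
  obtain ⟨K', W', i', p', hW', hK', hse'⟩ := hfrob.exists_omega hP
  obtain ⟨Q, a, b, c, hab, hc⟩ := hse'.exists_comp (h.pullback_fst p)
  have hQ := hfrob.leftThick.1.2 _ _ hc (hfrob.relGen.1 hW') (hfrob.relGen.1 hW)
  exact hfrob.resHat_closedUnderCokernelsOfMonos a b hab hK' (subset_resHat _ hQ)

theorem resHat_closedUnderSummands (hfrob : StrongLeftFrobeniusPair XX ωω) :
    ClosedUnderSummands (resHat XX) := by
  rintro M A ⟨n, hM⟩ s r hsr
  induction n generalizing M A with
  | zero =>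
    cases hM with
    | zero hX e =>
      exact subset_resHat _
        (hfrob.leftThick.2 (hfrob.leftThick.2.mem_of_iso hX e) s r hsr)
  | succ n ih =>
    obtain ⟨K, W, i, p, hW, hK, hse⟩ := hfrob.exists_omega_of_succ hM
    have := hse.mono
    have := hse.epi
    have : Epi r := epi_of_epi_fac hsr
    obtain ⟨h, hh⟩ := hse.exists_factor (hfrob.ext_vanishing hW ⟨n, hK⟩ one_pos)
      (p - p ≫ r ≫ s)
    obtain ⟨l, hl⟩ := hse.exists_lift (kernel.ι (p ≫ r) - kernel.ι (p ≫ r) ≫ h) (by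
      have := kernel.condition (p ≫ r)
      rw [← Category.assoc] at this
      simp [hh, reassoc_of% this])
    refine mem_resHat_of_isShortExactSeq (isShortExactSeq_kernel (p ≫ r)) (hfrob.relGen.1 hW)
      (ih (M := K ⊞ W) ?_ (biprod.lift l (kernel.ι (p ≫ r)))
        (biprod.desc (kernel.lift (p ≫ r) i (by simp [reassoc_of% hse.1]))
          (kernel.lift (p ≫ r) h (by simp [reassoc_of% hh, hsr]))) ?_)
    · exact hK.of_extension hfrob.leftThick (isShortExactSeq_biprod K W) (hfrob.relGen.1 hW)
    · rw [← cancel_mono (kernel.ι (p ≫ r))]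
      simp [hl]

theorem resHat_isThickClass (hfrob : StrongLeftFrobeniusPair XX ωω) :
    IsThickClass (resHat XX) :=
  ⟨⟨⟨hfrob.resHat_closedUnderExtensions, hfrob.resHat_closedUnderKernelsOfEpis⟩,
      hfrob.resHat_closedUnderSummands⟩,
    ⟨⟨hfrob.resHat_closedUnderExtensions, hfrob.resHat_closedUnderCokernelsOfMonos⟩,
      hfrob.resHat_closedUnderSummands⟩⟩

theorem mem_resHat_omega_iff (hfrob : StrongLeftFrobeniusPair XX ωω) {M : C} :
    M ∈ resHat ωω ↔ M ∈ resHat XX ∧ ∃ n, relProjDimLE.{w} (resHat XX) M n := by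
  constructor
  · rintro ⟨n, hM⟩
    refine ⟨⟨n, hM.mono hfrob.relGen.1⟩, n, ?_⟩
    induction hM with
    | zero hX e =>
      exact fun S hS j hj => hfrob.ext_vanishing (hfrob.summands.mem_of_iso hX e) hS hj
    | succ K X hX i p hse _ ih =>
      rintro S hS (_ | j) hj
      · exact absurd hj (Nat.not_lt_zero _)
      · exact hse.ext_right_vanishing S j (ih S hS j (Nat.lt_of_succ_lt_succ hj))
          (hfrob.ext_vanishing hX hS j.succ_pos)
  · rintro ⟨hM, n, hn⟩
    induction n generalizing M with
    | zero =>
      exact subset_resHat _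
        (hfrob.mem_omega_of_ext_vanishing hM fun S hS => hn S hS 1 one_pos)
    | succ n ih =>
      obtain ⟨K, W, i, p, hW, hK, hse⟩ := hfrob.exists_omega hM
      exact mem_resHat_of_isShortExactSeq hse hW (ih hK fun S hS j hj =>
        hse.ext_left_vanishing S j (hfrob.ext_vanishing hW hS (Nat.zero_lt_of_lt hj))
          (hn S hS (j + 1) (Nat.succ_lt_succ hj)))

theorem resHat_omega_isThickClass (hfrob : StrongLeftFrobeniusPair XX ωω) :
    IsThickClass (resHat ωω) := by
  have hT := hfrob.resHat_isThickClass
  have hext : ClosedUnderExtensions (resHat ωω) := by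
    intro A B D f g h hA hD
    rw [hfrob.mem_resHat_omega_iff] at hA hD ⊢
    obtain ⟨hA, m, hm⟩ := hA
    obtain ⟨hD, n, hn⟩ := hD
    exact ⟨hT.1.1.1 f g h hA hD, max m n, fun S hS j hj => h.ext_middle_vanishing S j
      (hm S hS j (by omega)) (hn S hS j (by omega))⟩
  have hsum : ClosedUnderSummands (resHat ωω) := by
    intro M A hM s r hsr
    rw [hfrob.mem_resHat_omega_iff] at hM ⊢
    obtain ⟨hM, n, hn⟩ := hM
    exact ⟨hT.1.2 hM s r hsr, n, fun S hS j hj =>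
      ext_vanishing_of_retract s r hsr S j (hn S hS j hj)⟩
  refine ⟨⟨⟨hext, ?_⟩, hsum⟩, ⟨hext, ?_⟩, hsum⟩
  · intro A B D f g h hB hD
    rw [hfrob.mem_resHat_omega_iff] at hB hD ⊢
    obtain ⟨hB, m, hm⟩ := hB
    obtain ⟨hD, n, hn⟩ := hD
    exact ⟨hT.1.1.2 f g h hB hD, max m n, fun S hS j hj => h.ext_left_vanishing S j
      (hm S hS j (by omega)) (hn S hS (j + 1) (by omega))⟩
  · intro A B D f g h hA hB
    rw [hfrob.mem_resHat_omega_iff] at hA hB ⊢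
    obtain ⟨hA, m, hm⟩ := hA
    obtain ⟨hB, n, hn⟩ := hB
    refine ⟨hT.2.1.2 f g h hA hB, max m n + 1, ?_⟩
    rintro S hS (_ | j) hj
    · exact absurd hj (Nat.not_lt_zero _)
    · exact h.ext_right_vanishing S j (hm S hS j (by omega)) (hn S hS (j + 1) (by omega))

theorem resHat_omega_eq_thickClosure (hfrob : StrongLeftFrobeniusPair XX ωω) :
    resHat ωω = thickClosure ωω :=
  Set.Subset.antisymm
    (fun _ hM _ hT => resHat_subset_of_isThickClass hT.1 hT.2 hM)
    (Set.sInter_subset_of_mem ⟨hfrob.resHat_omega_isThickClass, subset_resHat ωω⟩)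

theorem zero_mem_omega (hfrob : StrongLeftFrobeniusPair XX ωω) {M : C}
    (hM : M ∈ resHat XX) : (0 : C) ∈ ωω := by
  obtain ⟨_, _, _, _, hW, -⟩ := hfrob.exists_omega hM
  exact hfrob.summands hW 0 0 ((isZero_zero C).eq_of_src _ _)

theorem isCotorsionPair (hfrob : StrongLeftFrobeniusPair XX ωω) :
    IsCotorsionPair (resHat XX) ωω (resHat XX) := by
  have hsub : ωω ⊆ resHat XX := hfrob.relGen.1.trans (subset_resHat XX)
  refine ⟨⟨hsub, subset_rfl, hfrob.omega_eq, fun M hM => ?_⟩, hsub, subset_rfl, ?_,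
    fun M hM => ⟨M, 0, 𝟙 M, 0, hM, hfrob.zero_mem_omega hM, isShortExactSeq_id_zero M⟩⟩
  · obtain ⟨K, W, i, p, hW, hK, h⟩ := hfrob.exists_omega hM
    exact ⟨K, W, i, p, hK, hW, h⟩
  · exact Set.Subset.antisymm
      (fun M hM => ⟨hM, fun W hW => hfrob.ext_vanishing hW hM one_pos⟩) fun _ hM => hM.1

end StrongLeftFrobeniusPair

/-- Theorem on the projective pair. For a strong left Frobenius
pair `(X,ω)`: (a) `(ω, X^∧)` is an `X^∧`-cotorsion pair; (b) `ω^∧` is the smallest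
thick class containing `ω`. Consequently `ω` is the class of projective objects of the
exact category `X^∧`, and `X^∧` has enough projectives. -/
theorem stmt14 (XX ωω : Set C) (hfrob : StrongLeftFrobeniusPair XX ωω) :
    IsCotorsionPair (resHat XX) ωω (resHat XX) ∧
    resHat ωω = thickClosure ωω ∧
    ωω = {W | W ∈ resHat XX ∧ ∀ S ∈ resHat XX, Subsingleton (Abelian.Ext.{w} W S 1)} ∧
    ∀ M ∈ resHat XX, ∃ (K W : C) (i : K ⟶ W) (p : W ⟶ M),
      W ∈ ωω ∧ K ∈ resHat XX ∧ IsShortExactSeq i p := by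
  exact ⟨hfrob.isCotorsionPair, hfrob.resHat_omega_eq_thickClosure, hfrob.omega_eq,
    fun _ hM => hfrob.exists_omega hM⟩

end ABFormal
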